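/- Let A be a square matrix with nonnegative integer entries indexed by a finite type, and fix an index i. Then there exist a real number b ≥ 0, a natural number ℓ, and real constants c₁, c₂ > 0 such that for all but finitely many n ∈ ℕ, c₁ b^n n^ℓ ≤ Σ_j (A^n)_{i j} ≤ c₂ b^n n^ℓ. (Interpreting A as the adjacency matrix of a finite quiver, the number of paths of length n starting at a fixed vertex grows poly-exponentially.) -/

import Mathlib

open Finset

/-- The existence part of the Perron-Frobenius theorem. -/
theorem exists_pos_eigenvector_of_commute_pos {σ : Type*} [Fintype σ] [Nonempty σ]
    (B P : Matrix σ σ ℝ) (hB : ∀ i j, 0 ≤ B i j) (hP : ∀ i j, 0 < P i j) (hc : Commute P B) :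
    ∃ (u : σ → ℝ) (b : ℝ), (∀ i, 0 < u i) ∧ 0 ≤ b ∧ B.mulVec u = b • u := by
  classical
  have Ppos : ∀ v : σ → ℝ, (∀ i, 0 ≤ v i) → v ≠ 0 → ∀ i, 0 < P.mulVec v i := by
    intro v hv hv0 i
    obtain ⟨j, hj⟩ := Function.ne_iff.mp hv0
    exact sum_pos' (fun k _ => mul_nonneg (hP i k).le (hv k))
      ⟨j, mem_univ j, mul_pos (hP i j) ((hv j).lt_of_ne' hj)⟩
  set R : ℝ := ∑ i, ∑ j, B i j with hR
  have hbound : ∀ (r : ℝ) (u : σ → ℝ), u ∈ stdSimplex ℝ σ →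
      (∀ i, r * u i ≤ B.mulVec u i) → r ≤ R := by
    intro r u hu h
    calc r = ∑ i, r * u i := by rw [← mul_sum, hu.2, mul_one]
      _ ≤ ∑ i, B.mulVec u i := sum_le_sum fun i _ => h i
      _ ≤ R := sum_le_sum fun i _ => sum_le_sum fun j _ =>
        mul_le_of_le_one_right (hB i j)
          (hu.2 ▸ single_le_sum (fun k _ => hu.1 k) (mem_univ j))
  let K : Set ((σ → ℝ) × ℝ) :=
    (stdSimplex ℝ σ ×ˢ Set.Icc 0 R) ∩ {p | ∀ i, p.2 * p.1 i ≤ B.mulVec p.1 i}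
  have hclosed : IsClosed {p : (σ → ℝ) × ℝ | ∀ i, p.2 * p.1 i ≤ B.mulVec p.1 i} := by
    simp only [Set.ofPred_forall, Matrix.mulVec, dotProduct]
    exact isClosed_iInter fun i => isClosed_le (by fun_prop) (by fun_prop)
  have hK : IsCompact K := ((isCompact_stdSimplex ℝ σ).prod isCompact_Icc).inter_right hclosed
  have hKne : K.Nonempty := by
    obtain ⟨i⟩ := ‹Nonempty σ›
    refine ⟨(Pi.single i 1, 0), ⟨single_mem_stdSimplex ℝ i, le_rfl,
      sum_nonneg fun i _ => sum_nonneg fun j _ => hB i j⟩, fun k => ?_⟩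
    simpa using hB k i
  obtain ⟨⟨u, r⟩, ⟨⟨hu, hr⟩, hur⟩, hmax⟩ := hK.exists_isMaxOn hKne continuous_snd.continuousOn
  simp only [Set.mem_ofPred_eq] at hu hr hur
  have hu0 : u ≠ 0 := by
    rintro rfl
    simpa using hu.2
  have hw := Ppos u hu.1 hu0
  have hcomm : B.mulVec (P.mulVec u) = P.mulVec (B.mulVec u) := by
    rw [Matrix.mulVec_mulVec, Matrix.mulVec_mulVec, hc.eq]
  by_cases hv : B.mulVec u - r • u = 0
  · refine ⟨P.mulVec u, r, hw, hr.1, ?_⟩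
    rw [hcomm, sub_eq_zero.mp hv, Matrix.mulVec_smul]
  exfalso
  have hPv := Ppos _ (fun i => by simpa using hur i) hv
  have hev : ∀ᶠ ε : ℝ in nhdsWithin 0 (Set.Ioi 0),
      ∀ i, ε * P.mulVec u i < P.mulVec (B.mulVec u - r • u) i := by
    refine Filter.eventually_all.mpr fun i => nhdsWithin_le_nhds ?_
    refine ContinuousAt.eventually_lt (by fun_prop) continuousAt_const ?_
    simpa using hPv i
  obtain ⟨ε, hε, hε0⟩ := (hev.and self_mem_nhdsWithin).exists
  have hε0 : 0 < ε := hε0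
  set w := P.mulVec u with hwdef
  have hs : 0 < ∑ i, w i := sum_pos (fun i _ => hw i) univ_nonempty
  set s := ∑ i, w i with hsdef
  have hmem : s⁻¹ • w ∈ stdSimplex ℝ σ := by
    refine ⟨fun i => mul_nonneg (inv_nonneg.mpr hs.le) (hw i).le, ?_⟩
    simp only [Pi.smul_apply, smul_eq_mul, ← mul_sum]
    exact inv_mul_cancel₀ hs.ne'
  have hle : ∀ i, (r + ε) * (s⁻¹ • w) i ≤ B.mulVec (s⁻¹ • w) i := by
    intro i
    have h := hε i
    rw [Matrix.mulVec_sub, Matrix.mulVec_smul, ← hcomm, Pi.sub_apply, Pi.smul_apply,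
      smul_eq_mul, ← hwdef] at h
    rw [Matrix.mulVec_smul, Pi.smul_apply, Pi.smul_apply, smul_eq_mul, smul_eq_mul,
      mul_left_comm]
    refine mul_le_mul_of_nonneg_left ?_ (inv_nonneg.mpr hs.le)
    linarith
  have hmem' : ((s⁻¹ • w, r + ε) : (σ → ℝ) × ℝ) ∈ K :=
    ⟨⟨hmem, by have := hr.1; positivity, hbound _ _ hmem hle⟩, hle⟩
  have : r + ε ≤ r := hmax hmem'
  linarith

theorem exists_pos_eigenvector_of_exists_pow_pos {σ : Type*} [Fintype σ] [DecidableEq σ]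
    [Nonempty σ] (B : Matrix σ σ ℝ) (hB : ∀ i j, 0 ≤ B i j) (h : ∀ i j, ∃ n, 0 < (B ^ n) i j) :
    ∃ (u : σ → ℝ) (b : ℝ), (∀ i, 0 < u i) ∧ 0 ≤ b ∧ B.mulVec u = b • u := by
  choose e he using h
  refine exists_pos_eigenvector_of_commute_pos B (∑ i, ∑ j, B ^ e i j) hB (fun i j => ?_)
    (Commute.sum_left _ _ _ fun i _ => Commute.sum_left _ _ _ fun j _ => Commute.pow_self B _)
  have hpow : ∀ n i j, 0 ≤ (B ^ n) i j := fun n => Matrix.pow_apply_nonneg hB n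
  simp only [Matrix.sum_apply]
  exact sum_pos' (fun k _ => sum_nonneg fun l _ => hpow _ i j)
    ⟨i, mem_univ i, sum_pos' (fun l _ => hpow _ i j) ⟨j, mem_univ j, he i j⟩⟩

/-- Eventual two-sided comparison of a sequence with `b ^ n * n ^ ℓ`. -/
def IsPolyExponential (f : ℕ → ℝ) (b : ℝ) (ℓ : ℕ) : Prop :=
  ∃ c₁ c₂ : ℝ, 0 < c₁ ∧ 0 < c₂ ∧ ∀ᶠ n : ℕ in Filter.atTop,
    c₁ * (b ^ n * (n : ℝ) ^ ℓ) ≤ f n ∧ f n ≤ c₂ * (b ^ n * (n : ℝ) ^ ℓ)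

namespace IsPolyExponential

theorem of_bounds {f g : ℕ → ℝ} {b : ℝ} {ℓ : ℕ} (hf : IsPolyExponential f b ℓ) {k K : ℝ}
    (hk : 0 < k) (hK : 0 < K) (h₁ : ∀ n, k * f n ≤ g n) (h₂ : ∀ n, g n ≤ K * f n) :
    IsPolyExponential g b ℓ := by
  obtain ⟨c₁, c₂, hc₁, hc₂, h⟩ := hf
  refine ⟨k * c₁, K * c₂, mul_pos hk hc₁, mul_pos hK hc₂, h.mono fun n hn => ⟨?_, ?_⟩⟩
  · rw [mul_assoc]
    exact (mul_le_mul_of_nonneg_left hn.1 hk.le).trans (h₁ n)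
  · rw [mul_assoc]
    exact (h₂ n).trans (mul_le_mul_of_nonneg_left hn.2 hK.le)

theorem zero : IsPolyExponential 0 0 0 := by
  refine ⟨1, 1, one_pos, one_pos, (Filter.eventually_gt_atTop 0).mono fun n hn => ?_⟩
  simp [hn.ne']

theorem add_of_le {f g : ℕ → ℝ} {b b' C : ℝ} {ℓ ℓ' : ℕ} (hb : 0 ≤ b)
    (hf : IsPolyExponential f b ℓ) (hg : IsPolyExponential g b' ℓ') (hC : 0 ≤ C)
    (h : ∀ᶠ n : ℕ in Filter.atTop, b ^ n * (n : ℝ) ^ ℓ ≤ C * (b' ^ n * (n : ℝ) ^ ℓ')) :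
    IsPolyExponential (f + g) b' ℓ' := by
  obtain ⟨c₁, c₂, hc₁, hc₂, hf⟩ := hf
  obtain ⟨d₁, d₂, hd₁, hd₂, hg⟩ := hg
  refine ⟨d₁, c₂ * C + d₂, hd₁, by positivity, ?_⟩
  filter_upwards [h, hf, hg] with n hn hfn hgn
  have h₀ : 0 ≤ c₁ * (b ^ n * (n : ℝ) ^ ℓ) := by positivity
  have h₁ := mul_le_mul_of_nonneg_left hn hc₂.le
  constructor
  · exact hgn.1.trans (le_add_of_nonneg_left (h₀.trans hfn.1))
  · rw [add_mul, mul_assoc]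
    exact add_le_add (hfn.2.trans h₁) hgn.2

end IsPolyExponential

theorem eventually_pow_mul_pow_le_pow {b b' : ℝ} (hb : 0 ≤ b) (h : b < b') (ℓ : ℕ) :
    ∀ᶠ n : ℕ in Filter.atTop, b ^ n * (n : ℝ) ^ ℓ ≤ b' ^ n := by
  have hlt : ‖b‖ < b' := by rwa [Real.norm_of_nonneg hb]
  have hb' : 0 < b' := hb.trans_lt h
  filter_upwards
    [(isLittleO_pow_const_mul_const_pow_const_pow_of_norm_lt ℓ hlt).bound one_pos] with n hn
  rw [one_mul, Real.norm_of_nonneg (by positivity), Real.norm_of_nonneg (by positivity)] at hn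
  rwa [mul_comm]

theorem eventually_pow_mul_pow_le {b b' : ℝ} (hb : 0 ≤ b) {ℓ ℓ' : ℕ}
    (h : b < b' ∨ b = b' ∧ ℓ ≤ ℓ') :
    ∀ᶠ n : ℕ in Filter.atTop, b ^ n * (n : ℝ) ^ ℓ ≤ 1 * (b' ^ n * (n : ℝ) ^ ℓ') := by
  rcases h with h | ⟨rfl, h⟩
  · filter_upwards [eventually_pow_mul_pow_le_pow hb h ℓ, Filter.eventually_ge_atTop 1]
      with n hn h1
    have : (1 : ℝ) ≤ (n : ℝ) ^ ℓ' := one_le_pow₀ (by exact_mod_cast h1)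
    rw [one_mul]
    exact hn.trans (le_mul_of_one_le_right (pow_nonneg (hb.trans h.le) n) this)
  · filter_upwards [Filter.eventually_ge_atTop 1] with n h1
    have : (1 : ℝ) ≤ n := by exact_mod_cast h1
    rw [one_mul]
    gcongr

namespace IsPolyExponential

theorem add {f g : ℕ → ℝ} {b b' : ℝ} {ℓ ℓ' : ℕ} (hb : 0 ≤ b) (hb' : 0 ≤ b')
    (hf : IsPolyExponential f b ℓ) (hg : IsPolyExponential g b' ℓ') :
    ∃ (d : ℝ) (m : ℕ), 0 ≤ d ∧ IsPolyExponential (f + g) d m := by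
  have key : (b < b' ∨ b = b' ∧ ℓ ≤ ℓ') ∨ (b' < b ∨ b' = b ∧ ℓ' ≤ ℓ) := by
    rcases lt_trichotomy b b' with h | h | h
    · exact .inl (.inl h)
    · exact (le_total ℓ ℓ').imp (fun h' => .inr ⟨h, h'⟩) (fun h' => .inr ⟨h.symm, h'⟩)
    · exact .inr (.inl h)
  rcases key with h | h
  · exact ⟨b', ℓ', hb', add_of_le hb hf hg zero_le_one (eventually_pow_mul_pow_le hb h)⟩
  · exact ⟨b, ℓ, hb,
      add_comm f g ▸ add_of_le hb' hg hf zero_le_one (eventually_pow_mul_pow_le hb' h)⟩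

theorem sum {α : Type*} (s : Finset α) (f : α → ℕ → ℝ)
    (h : ∀ a ∈ s, ∃ (b : ℝ) (ℓ : ℕ), 0 ≤ b ∧ IsPolyExponential (f a) b ℓ) :
    ∃ (b : ℝ) (ℓ : ℕ), 0 ≤ b ∧ IsPolyExponential (∑ a ∈ s, f a) b ℓ :=
  sum_induction f (fun g => ∃ (b : ℝ) (ℓ : ℕ), 0 ≤ b ∧ IsPolyExponential g b ℓ)
    (fun _ _ ⟨_, _, hb, hf⟩ ⟨_, _, hb', hg⟩ => hf.add hb hb' hg) ⟨0, 0, le_rfl, zero⟩ h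

end IsPolyExponential

theorem add_one_pow_succ_le (x : ℝ) (hx : 0 ≤ x) (ℓ : ℕ) :
    (x + 1) ^ (ℓ + 1) ≤ x ^ (ℓ + 1) + (ℓ + 1) * (x + 1) ^ ℓ := by
  induction ℓ with
  | zero => simp
  | succ ℓ ih =>
    have := mul_le_mul_of_nonneg_left ih hx
    push_cast
    calc (x + 1) ^ (ℓ + 1 + 1) = x * (x + 1) ^ (ℓ + 1) + (x + 1) ^ (ℓ + 1) := by ring
      _ ≤ x * (x ^ (ℓ + 1) + (ℓ + 1) * (x + 1) ^ ℓ) + (x + 1) ^ (ℓ + 1) := by gcongr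
      _ ≤ x * (x ^ (ℓ + 1) + (ℓ + 1) * (x + 1) ^ ℓ) + (x + 1) ^ (ℓ + 1)
          + (ℓ + 1) * (x + 1) ^ ℓ := le_add_of_nonneg_right (by positivity)
      _ = _ := by ring

/-- A comparison valid for large `n` at one step propagates along a recursive inequality. -/
theorem eventually_le_of_rec {f F : ℕ → ℝ} {N : ℕ} (h₀ : f N ≤ F N)
    (h : ∀ n ≥ N, f n ≤ F n → f (n + 1) ≤ F (n + 1)) : ∀ᶠ n in Filter.atTop, f n ≤ F n :=
  (Filter.eventually_ge_atTop N).mono fun _ hn => Nat.le_induction h₀ h _ hn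

theorem exists_pos_threshold {p : ℕ → Prop} (h : ∀ᶠ n in Filter.atTop, p n) :
    ∃ N > 0, ∀ n ≥ N, p n := by
  obtain ⟨N, hN⟩ := Filter.eventually_atTop.mp h
  exact ⟨N + 1, N.succ_pos, fun n hn => hN n (by omega)⟩

section Recursion

variable {T g : ℕ → ℝ} {b β : ℝ} {ℓ : ℕ}

theorem pos_of_rec (hb : 0 < b) (hT0 : 0 < T 0) (hg0 : ∀ n, 0 ≤ g n)
    (hT : ∀ n, T (n + 1) = b * T n + g n) (n : ℕ) : 0 < T n := by
  induction n with
  | zero => exact hT0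
  | succ n ih => rw [hT]; have := hg0 n; positivity

theorem isPolyExponential_rec_of_lt (hβ : 0 ≤ β) (h : β < b) (hT0 : 0 < T 0)
    (hg0 : ∀ n, 0 ≤ g n) (hT : ∀ n, T (n + 1) = b * T n + g n)
    (hg : IsPolyExponential g β ℓ) : IsPolyExponential T b 0 := by
  have hb : 0 < b := hβ.trans_lt h
  obtain ⟨c₁, c₂, hc₁, hc₂, hg⟩ := hg
  set q := (β + b) / 2 with hq
  have hqb : q < b := by linarith
  have hq0 : 0 ≤ q := by positivity
  set D := c₂ / (b - q) with hD
  have hD0 : 0 < D := div_pos hc₂ (by linarith)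
  have hDb : c₂ + D * q = b * D := by
    have : b - q ≠ 0 := by linarith
    rw [hD]; field_simp; ring
  obtain ⟨N, -, hN⟩ := exists_pos_threshold
    (hg.and (eventually_pow_mul_pow_le_pow hβ (show β < q by linarith) ℓ))
  have hTN := pos_of_rec hb hT0 hg0 hT N
  set K := (T N + D * q ^ N) / b ^ N with hK
  have hK0 : 0 < K := by positivity
  refine ⟨T 0, K, hT0, hK0, Filter.Eventually.and ?_ ?_⟩
  · refine eventually_le_of_rec (N := 0) (by simp) fun n _ ih => ?_
    have := hg0 n
    have := mul_le_mul_of_nonneg_left ih hb.le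
    rw [hT]
    simp only [pow_zero, mul_one, pow_succ] at *
    nlinarith
  · have : ∀ᶠ n in Filter.atTop, T n + D * q ^ n ≤ K * b ^ n := by
      refine eventually_le_of_rec (N := N) (by rw [hK]; field_simp; rfl) fun n hn ih => ?_
      obtain ⟨⟨-, h₁⟩, h₂⟩ := hN n hn
      have h₃ := mul_le_mul_of_nonneg_left h₂ hc₂.le
      calc T (n + 1) + D * q ^ (n + 1) ≤ b * T n + c₂ * q ^ n + D * q ^ (n + 1) := by
            rw [hT]; linarith
        _ = b * T n + (c₂ + D * q) * q ^ n := by ring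
        _ = b * (T n + D * q ^ n) := by rw [hDb]; ring
        _ ≤ b * (K * b ^ n) := mul_le_mul_of_nonneg_left ih hb.le
        _ = K * b ^ (n + 1) := by ring
    filter_upwards [this] with n hn
    have : 0 ≤ D * q ^ n := by positivity
    simp only [pow_zero, mul_one]
    linarith

theorem isPolyExponential_rec_of_gt (hb : 0 ≤ b) (h : b < β) (hT0 : ∀ n, 0 ≤ T n)
    (hT : ∀ n, T (n + 1) = b * T n + g n)
    (hg : IsPolyExponential g β ℓ) : IsPolyExponential T β ℓ := by
  have hβ : 0 < β := hb.trans_lt h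
  obtain ⟨c₁, c₂, hc₁, hc₂, hg⟩ := hg
  obtain ⟨N, hN0, hN⟩ := exists_pos_threshold hg
  have hβb : 0 < β - b := sub_pos.mpr h
  have hNR : (0 : ℝ) < N := by exact_mod_cast hN0
  set K := max (c₂ / (β - b)) (T N / (β ^ N * N ^ ℓ)) with hK
  have hK0 : 0 < K := lt_max_of_lt_left (by positivity)
  have hKc : c₂ ≤ K * (β - b) := (div_le_iff₀ hβb).mp (le_max_left _ _)
  refine ⟨c₁ / (β * 2 ^ ℓ), K, by positivity, hK0, Filter.Eventually.and ?_ ?_⟩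
  · refine Filter.eventually_atTop.mpr ⟨N + 1, fun m hm => ?_⟩
    obtain ⟨n, rfl⟩ : ∃ n, m = n + 1 := ⟨m - 1, by omega⟩
    have hn : N ≤ n := by omega
    have hn1 : (1 : ℝ) ≤ n := by exact_mod_cast hN0.trans_le hn
    have hpow : ((n + 1 : ℕ) : ℝ) ^ ℓ ≤ 2 ^ ℓ * (n : ℝ) ^ ℓ := by
      rw [← mul_pow]
      gcongr
      push_cast; linarith
    calc c₁ / (β * 2 ^ ℓ) * (β ^ (n + 1) * ((n + 1 : ℕ) : ℝ) ^ ℓ)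
        ≤ c₁ / (β * 2 ^ ℓ) * (β ^ (n + 1) * (2 ^ ℓ * (n : ℝ) ^ ℓ)) := by gcongr
      _ = c₁ * (β ^ n * (n : ℝ) ^ ℓ) := by rw [pow_succ]; field_simp
      _ ≤ g n := (hN n hn).1
      _ ≤ T (n + 1) := by rw [hT]; exact le_add_of_nonneg_left (mul_nonneg hb (hT0 n))
  · refine eventually_le_of_rec (N := N) ?_ fun n hn ih => ?_
    · exact (div_le_iff₀ (by positivity)).mp (le_max_right _ _)
    · calc T (n + 1) ≤ b * (K * (β ^ n * (n : ℝ) ^ ℓ)) + c₂ * (β ^ n * (n : ℝ) ^ ℓ) := by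
            rw [hT]
            exact add_le_add (mul_le_mul_of_nonneg_left ih hb) (hN n hn).2
        _ ≤ b * (K * (β ^ n * (n : ℝ) ^ ℓ)) + K * (β - b) * (β ^ n * (n : ℝ) ^ ℓ) := by gcongr
        _ = K * (β ^ (n + 1) * (n : ℝ) ^ ℓ) := by ring
        _ ≤ K * (β ^ (n + 1) * ((n + 1 : ℕ) : ℝ) ^ ℓ) := by gcongr; simp

theorem isPolyExponential_rec_of_eq (hb : 0 < b) (hT0 : 0 < T 0) (hg0 : ∀ n, 0 ≤ g n)
    (hT : ∀ n, T (n + 1) = b * T n + g n)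
    (hg : IsPolyExponential g b ℓ) : IsPolyExponential T b (ℓ + 1) := by
  obtain ⟨c₁, c₂, hc₁, hc₂, hg⟩ := hg
  obtain ⟨N, hN0, hN⟩ := exists_pos_threshold hg
  have hNR : (0 : ℝ) < N := by exact_mod_cast hN0
  have hTN := pos_of_rec hb hT0 hg0 hT N
  set k := min (c₁ / (b * ((ℓ + 1) * 2 ^ ℓ))) (T N / (b ^ N * N ^ (ℓ + 1))) with hk
  have hk0 : 0 < k := lt_min (by positivity) (by positivity)
  have hkc : k * (b * ((ℓ + 1) * 2 ^ ℓ)) ≤ c₁ :=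
    (le_div_iff₀ (by positivity)).mp (min_le_left _ _)
  set K := max (c₂ / b) (T N / (b ^ N * N ^ (ℓ + 1))) with hK
  have hK0 : 0 < K := lt_max_of_lt_left (by positivity)
  have hKc : c₂ ≤ K * b := (div_le_iff₀ hb).mp (le_max_left _ _)
  refine ⟨k, K, hk0, hK0, Filter.Eventually.and ?_ ?_⟩
  · refine eventually_le_of_rec (N := N) ?_ fun n hn ih => ?_
    · exact (le_div_iff₀ (by positivity)).mp (min_le_right _ _)
    · have hn1 : (1 : ℝ) ≤ n := by exact_mod_cast hN0.trans_le hn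
      have hpow : ((n : ℝ) + 1) ^ ℓ ≤ 2 ^ ℓ * (n : ℝ) ^ ℓ := by
        rw [← mul_pow]
        gcongr
        linarith
      push_cast
      calc k * (b ^ (n + 1) * ((n : ℝ) + 1) ^ (ℓ + 1))
          ≤ k * (b ^ (n + 1) * ((n : ℝ) ^ (ℓ + 1) + (ℓ + 1) * ((n : ℝ) + 1) ^ ℓ)) := by
            gcongr
            exact add_one_pow_succ_le _ (by positivity) ℓ
        _ ≤ k * (b ^ (n + 1) * ((n : ℝ) ^ (ℓ + 1) + (ℓ + 1) * (2 ^ ℓ * (n : ℝ) ^ ℓ))) := by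
            gcongr
        _ = b * (k * (b ^ n * (n : ℝ) ^ (ℓ + 1)))
            + k * (b * ((ℓ + 1) * 2 ^ ℓ)) * (b ^ n * (n : ℝ) ^ ℓ) := by ring
        _ ≤ b * T n + c₁ * (b ^ n * (n : ℝ) ^ ℓ) := by gcongr
        _ ≤ T (n + 1) := by rw [hT]; linarith [(hN n hn).1]
  · refine eventually_le_of_rec (N := N) ?_ fun n hn ih => ?_
    · exact (div_le_iff₀ (by positivity)).mp (le_max_right _ _)
    · have hpow : (n : ℝ) ^ ℓ ≤ ((n : ℝ) + 1) ^ ℓ := by gcongr; linarith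
      push_cast
      calc T (n + 1) ≤ b * T n + c₂ * (b ^ n * (n : ℝ) ^ ℓ) := by rw [hT]; linarith [(hN n hn).2]
        _ ≤ b * (K * (b ^ n * (n : ℝ) ^ (ℓ + 1))) + K * b * (b ^ n * (n : ℝ) ^ ℓ) := by gcongr
        _ = K * (b ^ (n + 1) * ((n : ℝ) ^ ℓ * (n + 1))) := by ring
        _ ≤ K * (b ^ (n + 1) * (((n : ℝ) + 1) ^ ℓ * (n + 1))) := by gcongr
        _ = K * (b ^ (n + 1) * ((n : ℝ) + 1) ^ (ℓ + 1)) := by ring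

theorem isPolyExponential_rec_of_zero (hT : ∀ n, T (n + 1) = g n)
    (hg : IsPolyExponential g 0 ℓ) : IsPolyExponential T 0 0 := by
  obtain ⟨c₁, c₂, -, -, hg⟩ := hg
  obtain ⟨N, hN0, hN⟩ := exists_pos_threshold hg
  refine ⟨1, 1, one_pos, one_pos, Filter.eventually_atTop.mpr ⟨N + 1, fun m hm => ?_⟩⟩
  obtain ⟨n, rfl⟩ : ∃ n, m = n + 1 := ⟨m - 1, by omega⟩
  have h := hN n (by omega)
  have hn : n ≠ 0 := by omega
  simp only [zero_pow hn, zero_mul, mul_zero] at h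
  simpa [hT] using h

/-- A linear recursion of order one with poly-exponential forcing term has poly-exponential
solutions. -/
theorem exists_isPolyExponential_rec (hb : 0 ≤ b) (hβ : 0 ≤ β) (hT0 : 0 < T 0)
    (hTn : ∀ n, 0 ≤ T n) (hg0 : ∀ n, 0 ≤ g n) (hT : ∀ n, T (n + 1) = b * T n + g n)
    (hg : IsPolyExponential g β ℓ) :
    ∃ (d : ℝ) (m : ℕ), 0 ≤ d ∧ IsPolyExponential T d m := by
  rcases lt_trichotomy β b with h | rfl | h
  · exact ⟨b, 0, hb, isPolyExponential_rec_of_lt hβ h hT0 hg0 hT hg⟩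
  · rcases hb.eq_or_lt with rfl | hb
    · exact ⟨0, 0, le_rfl, isPolyExponential_rec_of_zero (by simpa using hT) hg⟩
    · exact ⟨β, ℓ + 1, hβ, isPolyExponential_rec_of_eq hb hT0 hg0 hT hg⟩
  · exact ⟨β, ℓ, hβ, isPolyExponential_rec_of_gt hb h hTn hT hg⟩

end Recursion

/-- Reachability in the quiver with adjacency matrix `A`. -/
abbrev Reaches {ι : Type*} (A : Matrix ι ι ℕ) : ι → ι → Prop :=
  Relation.ReflTransGen fun i j => 0 < A i j

theorem wellFounded_reaches_not_reaches {ι : Type*} [Finite ι] (A : Matrix ι ι ℕ) :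
    WellFounded fun k i => Reaches A i k ∧ ¬ Reaches A k i := by
  have : IsTrans ι fun k i => Reaches A i k ∧ ¬ Reaches A k i :=
    ⟨fun _ _ _ h h' => ⟨h'.1.trans h.1, fun h'' => h.2 (h''.trans h'.1)⟩⟩
  have : Std.Irrefl fun k i => Reaches A i k ∧ ¬ Reaches A k i := ⟨fun _ h => h.2 h.1⟩
  exact Finite.wellFounded_of_trans_of_irrefl _

section RowSum

variable {ι : Type*} [Fintype ι] [DecidableEq ι] (A : Matrix ι ι ℕ)

/-- The sum of the entries in row `i` of `A ^ n`. -/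
def rowSumPow (i : ι) (n : ℕ) : ℝ := ∑ j, (((A ^ n) i j : ℕ) : ℝ)

theorem rowSumPow_nonneg (i : ι) (n : ℕ) : 0 ≤ rowSumPow A i n :=
  sum_nonneg fun _ _ => Nat.cast_nonneg _

theorem rowSumPow_zero (i : ι) : rowSumPow A i 0 = 1 := by
  simp [rowSumPow, Matrix.one_apply]

theorem rowSumPow_succ (i : ι) (n : ℕ) :
    rowSumPow A i (n + 1) = ∑ l, (A i l : ℝ) * rowSumPow A l n := by
  simp only [rowSumPow, pow_succ', Matrix.mul_apply, Nat.cast_sum, Nat.cast_mul, mul_sum]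
  exact sum_comm

theorem exists_rowSumPow_succ_le :
    ∃ M : ℝ, 0 < M ∧ ∀ i n, rowSumPow A i (n + 1) ≤ M * rowSumPow A i n := by
  refine ⟨1 + ∑ l, ∑ j, (A l j : ℝ), by positivity, fun i n => ?_⟩
  simp only [rowSumPow, pow_succ, Matrix.mul_apply, Nat.cast_sum, Nat.cast_mul]
  rw [sum_comm, mul_sum]
  refine sum_le_sum fun l _ => ?_
  rw [← mul_sum, mul_comm]
  refine mul_le_mul_of_nonneg_right ?_ (Nat.cast_nonneg _)
  have : ∑ j, (A l j : ℝ) ≤ ∑ l, ∑ j, (A l j : ℝ) :=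
    single_le_sum (f := fun l => ∑ j, (A l j : ℝ)) (fun l _ => by positivity) (mem_univ l)
  linarith

theorem exists_rowSumPow_le_of_reaches {i k : ι} (h : Reaches A i k) :
    ∃ K : ℝ, 0 < K ∧ ∀ n, rowSumPow A k n ≤ K * rowSumPow A i n := by
  obtain ⟨M, hM, hMle⟩ := exists_rowSumPow_succ_le A
  induction h with
  | refl => exact ⟨1, one_pos, fun n => by rw [one_mul]⟩
  | @tail l k _ hlk ih =>
    obtain ⟨K, hK, hKle⟩ := ih
    refine ⟨M * K, mul_pos hM hK, fun n => ?_⟩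
    have h1 : (1 : ℝ) ≤ A l k := by exact_mod_cast hlk
    calc rowSumPow A k n ≤ A l k * rowSumPow A k n :=
          le_mul_of_one_le_left (rowSumPow_nonneg A k n) h1
      _ ≤ ∑ m, (A l m : ℝ) * rowSumPow A m n :=
          single_le_sum (f := fun m => (A l m : ℝ) * rowSumPow A m n)
            (fun m _ => mul_nonneg (Nat.cast_nonneg _) (rowSumPow_nonneg A m n)) (mem_univ k)
      _ = rowSumPow A l (n + 1) := (rowSumPow_succ A l n).symm
      _ ≤ M * rowSumPow A l n := hMle l n
      _ ≤ M * K * rowSumPow A i n := by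
          rw [mul_assoc]
          exact mul_le_mul_of_nonneg_left (hKle n) hM.le

/-- The block of `A` on the strongly connected component of `i` has a positive left
eigenvector. -/
theorem exists_pos_left_eigenvector_component (i : ι) (C : ι → Prop) [DecidablePred C]
    (hC : ∀ j, C j ↔ Reaches A i j ∧ Reaches A j i) :
    ∃ (u : {j // C j} → ℝ) (b : ℝ), (∀ j, 0 < u j) ∧ 0 ≤ b ∧
      ∀ l : {j // C j}, ∑ j : {j // C j}, u j * A j l = b * u l := by
  have : Nonempty {j // C j} := ⟨⟨i, (hC i).mpr ⟨.refl, .refl⟩⟩⟩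
  let B : Matrix {j // C j} {j // C j} ℝ := Matrix.of fun j k => (A k j : ℝ)
  have hB : ∀ j k, 0 ≤ B j k := fun j k => Nat.cast_nonneg _
  have hpos : ∀ j k, ∃ n, 0 < (B ^ n) j k := by
    rintro j ⟨k, hk⟩
    have hkj : Reaches A k j := ((hC k).mp hk).2.trans ((hC j).mp j.2).1
    induction hkj using Relation.ReflTransGen.head_induction_on with
    | refl => exact ⟨0, by simp⟩
    | @head k l hkl hlj ih =>
      have hl : C l := (hC l).mpr ⟨((hC k).mp hk).1.tail hkl, hlj.trans ((hC j).mp j.2).2⟩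
      obtain ⟨n, hn⟩ := ih hl
      refine ⟨n + 1, ?_⟩
      rw [pow_succ, Matrix.mul_apply]
      refine sum_pos' (fun m _ => mul_nonneg (Matrix.pow_apply_nonneg hB n j m) (hB _ _))
        ⟨⟨l, hl⟩, mem_univ _, mul_pos hn ?_⟩
      exact Nat.cast_pos.mpr hkl
  obtain ⟨u, b, hu, hb, hub⟩ := exists_pos_eigenvector_of_exists_pow_pos B hB hpos
  refine ⟨u, b, hu, hb, fun l => ?_⟩
  rw [← smul_eq_mul, ← Pi.smul_apply, ← hub]
  exact sum_congr rfl fun j _ => mul_comm _ _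

theorem exists_isPolyExponential_rowSumPow (i : ι) :
    ∃ (b : ℝ) (ℓ : ℕ), 0 ≤ b ∧ IsPolyExponential (rowSumPow A i) b ℓ := by
  classical
  induction i using (wellFounded_reaches_not_reaches A).induction with
  | _ i ih =>
  let C : ι → Prop := fun j => Reaches A i j ∧ Reaches A j i
  have hCi : C i := ⟨.refl, .refl⟩
  obtain ⟨u, b, hu, hb, hub⟩ := exists_pos_left_eigenvector_component A i C fun _ => Iff.rfl
  let T : ℕ → ℝ := fun n => ∑ j : {j // C j}, u j * rowSumPow A j n
  let v : {k // ¬ C k} → ℝ := fun k => ∑ j : {j // C j}, u j * A j k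
  have hv : ∀ k, 0 ≤ v k := fun k =>
    sum_nonneg fun j _ => mul_nonneg (hu j).le (Nat.cast_nonneg _)
  let g : ℕ → ℝ := ∑ k, fun n => v k * rowSumPow A k n
  have hg_apply : ∀ n, g n = ∑ k, v k * rowSumPow A k n := fun n => by
    simp only [g, Finset.sum_apply]
  have hterm : ∀ n (j : {j // C j}), 0 ≤ u j * rowSumPow A j n := fun n j =>
    mul_nonneg (hu j).le (rowSumPow_nonneg A j n)
  have hT : ∀ n, T (n + 1) = b * T n + g n := by
    intro n
    have hsplit : T (n + 1) = ∑ l, (∑ j : {j // C j}, u j * A j l) * rowSumPow A l n := by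
      simp only [T, rowSumPow_succ, mul_sum, sum_mul, ← mul_assoc]
      exact sum_comm
    rw [hsplit, ← Fintype.sum_subtype_add_sum_subtype C, hg_apply]
    congr 1
    simp only [hub, T, mul_sum, mul_assoc]
  have hg : ∃ (β : ℝ) (ℓ : ℕ), 0 ≤ β ∧ IsPolyExponential g β ℓ := by
    refine IsPolyExponential.sum univ _ fun k _ => ?_
    rcases (hv k).eq_or_lt with h | h
    · refine ⟨0, 0, le_rfl, ?_⟩
      simp only [← h, zero_mul]
      exact IsPolyExponential.zero
    · obtain ⟨j, -, hj⟩ := exists_lt_of_sum_lt (s := univ) (f := fun _ => (0 : ℝ))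
        (g := fun j : {j // C j} => u j * A j k) (by simpa using h)
      have hjk : 0 < A j k := Nat.cast_pos.mp (pos_of_mul_pos_right hj (hu j).le)
      have hik : Reaches A i k := j.2.1.tail hjk
      obtain ⟨β, ℓ, hβ, hk⟩ := ih k ⟨hik, fun hki => k.2 ⟨hik, hki⟩⟩
      exact ⟨β, ℓ, hβ, hk.of_bounds h h (fun n => le_rfl) (fun n => le_rfl)⟩
  obtain ⟨β, ℓ, hβ, hg⟩ := hg
  have hT0 : 0 < T 0 := by
    simp only [T, rowSumPow_zero, mul_one]
    exact sum_pos (fun j _ => hu j) ⟨⟨i, hCi⟩, mem_univ _⟩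
  obtain ⟨d, m, hd, hTd⟩ := exists_isPolyExponential_rec hb hβ hT0
    (fun n => sum_nonneg fun j _ => hterm n j)
    (fun n => hg_apply n ▸ sum_nonneg fun k _ => mul_nonneg (hv k) (rowSumPow_nonneg A k n)) hT hg
  choose K hK hKle using fun j : {j // C j} => exists_rowSumPow_le_of_reaches A j.2.1
  have hS : 0 < ∑ j, u j * K j :=
    sum_pos (fun j _ => mul_pos (hu j) (hK j)) ⟨⟨i, hCi⟩, mem_univ _⟩
  refine ⟨d, m, hd, hTd.of_bounds (inv_pos.mpr hS) (inv_pos.mpr (hu ⟨i, hCi⟩))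
    (fun n => ?_) fun n => ?_⟩
  · rw [inv_mul_le_iff₀ hS, sum_mul]
    refine sum_le_sum fun j _ => ?_
    rw [mul_assoc]
    exact mul_le_mul_of_nonneg_left (hKle j n) (hu j).le
  · rw [le_inv_mul_iff₀ (hu _)]
    exact single_le_sum (f := fun j : {j // C j} => u j * rowSumPow A j n)
      (fun j _ => hterm n j) (mem_univ (⟨i, hCi⟩ : {j // C j}))

end RowSum

theorem row_sum_pow_polyExponential
    {ι : Type*} [Fintype ι] [DecidableEq ι]
    (A : Matrix ι ι ℕ) (i : ι) :
    ∃ (b : ℝ) (ℓ : ℕ) (c₁ c₂ : ℝ), 0 ≤ b ∧ 0 < c₁ ∧ 0 < c₂ ∧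
      ∀ᶠ n : ℕ in Filter.atTop,
        c₁ * (b ^ n * (n : ℝ) ^ ℓ) ≤ ∑ j, (((A ^ n) i j : ℕ) : ℝ) ∧
          ∑ j, (((A ^ n) i j : ℕ) : ℝ) ≤ c₂ * (b ^ n * (n : ℝ) ^ ℓ) := by
  obtain ⟨b, ℓ, hb, c₁, c₂, hc₁, hc₂, h⟩ := exists_isPolyExponential_rowSumPow A i
  exact ⟨b, ℓ, c₁, c₂, hb, hc₁, hc₂, h⟩
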